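/- arXiv:2211.14932 — 6 statements merged into one kernel-verified Lean document; each statement's English description precedes it below -/
import Mathlib

section
/- Let X be a finite set, let P and Q be probability distributions on X, let R > 0, and let h : X → ℝ satisfy 0 ≤ h(x) ≤ R for all x ∈ X. Then |E_P[h] − E_Q[h]| ≤ √(2R · (E_P[h] + E_Q[h]) · D_H²(P,Q)), where E_P[h] := Σ_{x∈X} P(x) h(x) and E_Q[h] := Σ_{x∈X} Q(x) h(x). -/
open scoped BigOperators

/-- Squared Hellinger distance between two distributions on a finite set. -/
noncomputable def hellingerSq {X : Type*} [Fintype X] (P Q : X → ℝ) : ℝ :=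
  ∑ x, (Real.sqrt (P x) - Real.sqrt (Q x)) ^ 2

theorem stmt0 {X : Type*} [Fintype X] (P Q : X → ℝ)
    (hP0 : ∀ x, 0 ≤ P x) (hP1 : (∑ x, P x) = 1)
    (hQ0 : ∀ x, 0 ≤ Q x) (hQ1 : (∑ x, Q x) = 1)
    (R : ℝ) (hR : 0 < R) (h : X → ℝ) (hh : ∀ x, 0 ≤ h x ∧ h x ≤ R) :
    |(∑ x, P x * h x) - ∑ x, Q x * h x| ≤
      Real.sqrt (2 * R * ((∑ x, P x * h x) + ∑ x, Q x * h x) * hellingerSq P Q) := by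
  have cauchy_schwarz := Finset.sum_mul_sq_le_sq_mul_sq Finset.univ
    (fun x => Real.sqrt (P x) - Real.sqrt (Q x))
    (fun x => (Real.sqrt (P x) + Real.sqrt (Q x)) * h x)
  have diff_eq : ∑ x, (Real.sqrt (P x) - Real.sqrt (Q x)) *
      ((Real.sqrt (P x) + Real.sqrt (Q x)) * h x) = (∑ x, P x * h x) - ∑ x, Q x * h x := by
    rw [← Finset.sum_sub_distrib]
    refine Finset.sum_congr rfl fun x _ => ?_
    linear_combination h x * Real.sq_sqrt (hP0 x) - h x * Real.sq_sqrt (hQ0 x)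
  have weight_le : ∑ x, ((Real.sqrt (P x) + Real.sqrt (Q x)) * h x) ^ 2 ≤
      2 * R * ((∑ x, P x * h x) + ∑ x, Q x * h x) := by
    rw [← Finset.sum_add_distrib, Finset.mul_sum]
    refine Finset.sum_le_sum fun x _ => ?_
    have sq_add_le : (Real.sqrt (P x) + Real.sqrt (Q x)) ^ 2 ≤ 2 * (P x + Q x) := by
      simpa only [Real.sq_sqrt (hP0 x), Real.sq_sqrt (hQ0 x)] using
        add_sq_le (a := Real.sqrt (P x)) (b := Real.sqrt (Q x))
    have sq_le : h x ^ 2 ≤ R * h x := by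
      rw [sq]
      exact mul_le_mul_of_nonneg_right (hh x).2 (hh x).1
    calc ((Real.sqrt (P x) + Real.sqrt (Q x)) * h x) ^ 2
        = (Real.sqrt (P x) + Real.sqrt (Q x)) ^ 2 * h x ^ 2 := mul_pow _ _ _
      _ ≤ 2 * (P x + Q x) * (R * h x) :=
          mul_le_mul sq_add_le sq_le (sq_nonneg _)
            (mul_nonneg zero_le_two (add_nonneg (hP0 x) (hQ0 x)))
      _ = 2 * R * (P x * h x + Q x * h x) := by ring
  apply Real.abs_le_sqrt
  rw [← diff_eq, mul_comm _ (hellingerSq P Q)]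
  exact cauchy_schwarz.trans <| mul_le_mul_of_nonneg_left weight_le <|
    Finset.sum_nonneg fun x _ => sq_nonneg _
end

section
/- Let X be a finite set, let P and Q be probability distributions on X, let R > 0, and let h : X → ℝ satisfy 0 ≤ h(x) ≤ R for all x ∈ X. Then E_P[h] ≤ 3 E_Q[h] + 4R · D_H²(P,Q), where E_P[h] := Σ_{x∈X} P(x) h(x) and E_Q[h] := Σ_{x∈X} Q(x) h(x). -/
open scoped BigOperators

theorem stmt1 {X : Type*} [Fintype X] (P Q : X → ℝ)
    (hP0 : ∀ x, 0 ≤ P x) (hP1 : (∑ x, P x) = 1)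
    (hQ0 : ∀ x, 0 ≤ Q x) (hQ1 : (∑ x, Q x) = 1)
    (R : ℝ) (hR : 0 < R) (h : X → ℝ) (hh : ∀ x, 0 ≤ h x ∧ h x ≤ R) :
    (∑ x, P x * h x) ≤ 3 * (∑ x, Q x * h x) + 4 * R * hellingerSq P Q := by
  rw [hellingerSq, Finset.mul_sum, Finset.mul_sum, ← Finset.sum_add_distrib]
  refine Finset.sum_le_sum fun x _ => ?_
  obtain ⟨h0, hx⟩ := hh x
  have hp := Real.sq_sqrt (hP0 x)
  have hq := Real.sq_sqrt (hQ0 x)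
  set p := Real.sqrt (P x)
  set q := Real.sqrt (Q x)
  have hpq : P x ≤ 3 * Q x + 4 * (p - q) ^ 2 := by
    nlinarith [sq_nonneg (p - q), sq_nonneg (2 * q - p)]
  have h_mul := mul_le_mul_of_nonneg_right hpq h0
  have h_bound := mul_le_mul_of_nonneg_left hx (sq_nonneg (p - q))
  linarith
end

section
/- Let X be a finite set, let P and Q be probability distributions on X, let R > 0, and let h : X → ℝ satisfy 0 ≤ h(x) ≤ R for all x ∈ X. Then for every real β ≥ 1, E_P[h] ≤ (1 + 1/β) · E_Q[h] + 3βR · D_H²(P,Q), where E_P[h] := Σ_{x∈X} P(x) h(x) and E_Q[h] := Σ_{x∈X} Q(x) h(x). -/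
open scoped BigOperators

theorem sq_le_one_add_inv_mul_sq_add_mul_sub_sq {β : ℝ} (hβ : 0 < β) (a b : ℝ) :
    a ^ 2 ≤ (1 + 1 / β) * b ^ 2 + (1 + β) * (a - b) ^ 2 := by
  have key : (1 + 1 / β) * b ^ 2 + (1 + β) * (a - b) ^ 2 - a ^ 2
      = (b - β * (a - b)) ^ 2 / β := by
    field_simp
    ring
  have : 0 ≤ (b - β * (a - b)) ^ 2 / β := by positivity
  linarith

theorem stmt2 {X : Type*} [Fintype X] (P Q : X → ℝ)
    (hP0 : ∀ x, 0 ≤ P x) (hP1 : (∑ x, P x) = 1)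
    (hQ0 : ∀ x, 0 ≤ Q x) (hQ1 : (∑ x, Q x) = 1)
    (R : ℝ) (hR : 0 < R) (h : X → ℝ) (hh : ∀ x, 0 ≤ h x ∧ h x ≤ R) :
    ∀ β : ℝ, 1 ≤ β →
      (∑ x, P x * h x) ≤ (1 + 1 / β) * (∑ x, Q x * h x) + 3 * β * R * hellingerSq P Q := by
  intro β hβ
  have hβ0 : 0 < β := by linarith
  unfold hellingerSq
  rw [Finset.mul_sum, Finset.mul_sum, ← Finset.sum_add_distrib]
  refine Finset.sum_le_sum fun x _ => ?_
  obtain ⟨h0, h1⟩ := hh x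
  have hsq := sq_le_one_add_inv_mul_sq_add_mul_sub_sq hβ0 √(P x) √(Q x)
  rw [Real.sq_sqrt (hP0 x), Real.sq_sqrt (hQ0 x)] at hsq
  set d := (√(P x) - √(Q x)) ^ 2
  have hd : 0 ≤ d := sq_nonneg _
  calc P x * h x ≤ ((1 + 1 / β) * Q x + (1 + β) * d) * h x := by gcongr
    _ = (1 + 1 / β) * (Q x * h x) + (1 + β) * h x * d := by ring
    _ ≤ (1 + 1 / β) * (Q x * h x) + 3 * β * R * d := by
      gcongr
      linarith
end

section
/- Let X be a finite set, let P and Q be probability distributions on X, let R > 0, and let h : X → ℝ satisfy 0 ≤ h(x) ≤ R for all x ∈ X. Then for every η ∈ (0,1), E_P[h] ≤ ((1+η)/(1−η)) · E_Q[h] + (R / (2η(1−η))) · D_H²(P,Q), where E_P[h] := Σ_{x∈X} P(x) h(x) and E_Q[h] := Σ_{x∈X} Q(x) h(x). -/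
open scoped BigOperators

/-- Weighted comparison of two squares, with the error measured by the squared difference. -/
theorem sq_le_mul_sq_add_sub_sq {η : ℝ} (h0 : 0 < η) (h1 : η < 1) (p q : ℝ) :
    p ^ 2 ≤ (1 + η) / (1 - η) * q ^ 2 + 1 / (2 * η * (1 - η)) * (p - q) ^ 2 := by
  have h1' : 0 < 1 - η := sub_pos.2 h1
  have key : (1 + η) / (1 - η) * q ^ 2 + 1 / (2 * η * (1 - η)) * (p - q) ^ 2 - p ^ 2 =
      (η ^ 2 * (p - q) ^ 2 + ((1 - η) * (p - q) - 2 * η * q) ^ 2) / (2 * η * (1 - η)) := by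
    field_simp
    ring
  rw [← sub_nonneg, key]
  positivity

theorem stmt3 {X : Type*} [Fintype X] (P Q : X → ℝ)
    (hP0 : ∀ x, 0 ≤ P x) (hP1 : (∑ x, P x) = 1)
    (hQ0 : ∀ x, 0 ≤ Q x) (hQ1 : (∑ x, Q x) = 1)
    (R : ℝ) (hR : 0 < R) (h : X → ℝ) (hh : ∀ x, 0 ≤ h x ∧ h x ≤ R) :
    ∀ η : ℝ, 0 < η → η < 1 →
      (∑ x, P x * h x) ≤ ((1 + η) / (1 - η)) * (∑ x, Q x * h x) +
        (R / (2 * η * (1 - η))) * hellingerSq P Q := by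
  intro η h0 h1
  have h1' : 0 < 1 - η := sub_pos.2 h1
  rw [hellingerSq, Finset.mul_sum, Finset.mul_sum, ← Finset.sum_add_distrib]
  refine Finset.sum_le_sum fun x _ => ?_
  obtain ⟨hx0, hxR⟩ := hh x
  have hsq := sq_le_mul_sq_add_sub_sq h0 h1 (√(P x)) (√(Q x))
  rw [Real.sq_sqrt (hP0 x), Real.sq_sqrt (hQ0 x)] at hsq
  calc P x * h x
      ≤ ((1 + η) / (1 - η) * Q x + 1 / (2 * η * (1 - η)) * (√(P x) - √(Q x)) ^ 2) * h x := by
        gcongr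
    _ = (1 + η) / (1 - η) * (Q x * h x) +
          h x / (2 * η * (1 - η)) * (√(P x) - √(Q x)) ^ 2 := by ring
    _ ≤ (1 + η) / (1 - η) * (Q x * h x) +
          R / (2 * η * (1 - η)) * (√(P x) - √(Q x)) ^ 2 := by gcongr
end

section
/- Let T ∈ ℕ with T ≥ 1, let λ > 0, and let x_1, …, x_T be reals with 0 ≤ x_t ≤ λ for all t. Define S_t := λ + Σ_{k=1}^{t−1} x_k. Then Σ_{t=1}^{T} x_t / S_t ≤ 2 · log(T + 1). -/
open scoped BigOperators

/-- On `[0, s]` the increment of `log` at `s` dominates half the relative increment. -/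
theorem div_le_two_mul_log_add_sub_log {s y : ℝ} (hs : 0 < s) (hy : 0 ≤ y) (hys : y ≤ s) :
    y / s ≤ 2 * (Real.log (s + y) - Real.log s) := by
  have hsy : 0 < s + y := by linarith
  have hlog := Real.one_sub_inv_le_log_of_pos (div_pos hsy hs)
  rw [Real.log_div hsy.ne' hs.ne', inv_div] at hlog
  have hfrac : y / s ≤ 2 * (1 - s / (s + y)) := by
    have heq : 2 * (1 - s / (s + y)) = 2 * y / (s + y) := by
      field_simp
      ring
    rw [heq, div_le_div_iff₀ hs hsy]
    nlinarith
  linarith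

/-- The sum of relative increments telescopes to twice the logarithmic growth. -/
theorem sum_div_le_two_mul_log_sub_log {lam : ℝ} (hlam : 0 < lam) {x : ℕ → ℝ} (n : ℕ)
    (hx : ∀ t ∈ Finset.Icc 1 n, 0 ≤ x t ∧ x t ≤ lam) :
    (∑ t ∈ Finset.Icc 1 n, x t / (lam + ∑ k ∈ Finset.Icc 1 (t - 1), x k)) ≤
      2 * (Real.log (lam + ∑ k ∈ Finset.Icc 1 n, x k) - Real.log lam) := by
  induction n with
  | zero => simp
  | succ n ih =>
    have hx' : ∀ t ∈ Finset.Icc 1 n, 0 ≤ x t ∧ x t ≤ lam := fun t ht =>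
      hx t (Finset.Icc_subset_Icc_right n.le_succ ht)
    have hsum : 0 ≤ ∑ k ∈ Finset.Icc 1 n, x k := Finset.sum_nonneg fun k hk => (hx' k hk).1
    obtain ⟨h0, h1⟩ := hx (n + 1) (by simp)
    have hstep := div_le_two_mul_log_add_sub_log
      (s := lam + ∑ k ∈ Finset.Icc 1 n, x k) (by linarith) h0 (by linarith)
    rw [Finset.sum_Icc_succ_top (by omega), Finset.sum_Icc_succ_top (by omega),
      Nat.add_sub_cancel, ← add_assoc]
    linarith [ih hx']

/-- Cumulative potential bound (`lemma:general-potential-bound`): if `0 ≤ x_t ≤ λ` and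
`S_t = λ + Σ_{k=1}^{t-1} x_k`, then `Σ_{t=1}^{T} x_t / S_t ≤ 2 log (T + 1)`. -/
theorem stmt7 (T : ℕ) (hT : 1 ≤ T) (lam : ℝ) (hlam : 0 < lam)
    (x : ℕ → ℝ) (hx : ∀ t ∈ Finset.Icc 1 T, 0 ≤ x t ∧ x t ≤ lam) :
    (∑ t ∈ Finset.Icc 1 T, x t / (lam + ∑ k ∈ Finset.Icc 1 (t - 1), x k)) ≤
      2 * Real.log (T + 1) := by
  refine (sum_div_le_two_mul_log_sub_log hlam T hx).trans ?_
  have hsum : 0 ≤ ∑ k ∈ Finset.Icc 1 T, x k := Finset.sum_nonneg fun k hk => (hx k hk).1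
  have hle : ∑ k ∈ Finset.Icc 1 T, x k ≤ T * lam := by
    simpa using Finset.sum_le_card_nsmul _ _ lam fun k hk => (hx k hk).2
  have hlog : Real.log (lam + ∑ k ∈ Finset.Icc 1 T, x k) ≤ Real.log ((T + 1) * lam) :=
    Real.log_le_log (by linarith) (by linarith)
  rw [Real.log_mul (by positivity) hlam.ne'] at hlog
  linarith
end

section
/- Let S be a finite state space, A a finite action set, and H ≥ 1 a horizon. Let M and M' be two finite-horizon MDPs on (S,A) with time-indexed transition kernels p_h(·|s,a) and p'_h(·|s,a) (probability distributions on S for each h ∈ {1,…,H−1}, s ∈ S, a ∈ A) and time-indexed cost functions c_h, c'_h : S × A → ℝ, and let π = (π_h)_h and π' = (π'_h)_h be stochastic policies, π_h(·|s), π'_h(·|s) being probability distributions on A. Define V^{π,M}_H(s) := 0, Q^{π,M}_h(s,a) := c_h(s,a) + Σ_{s'} p_h(s'|s,a) V^{π,M}_{h+1}(s'), and V^{π,M}_h(s) := Σ_a π_h(a|s) Q^{π,M}_h(s,a), and similarly for (M',π'). Then for every initial state s: V^{π,M}_1(s) − V^{π',M'}_1(s) = Σ_{h=1}^{H−1} E_{π',M'}[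 Σ_{a∈A} Q^{π,M}_h(s_h,a) · (π_h(a|s_h) − π'_h(a|s_h)) | s_1 = s ] + Σ_{h=1}^{H−1} E_{π',M'}[ c_h(s_h,a_h) − c'_h(s_h,a_h) + Σ_{s'∈S} (p_h(s'|s_h,a_h) − p'_h(s'|s_h,a_h)) · V^{π,M}_{h+1}(s') | s_1 = s ], where E_{π',M'}[ · | s_1 = s ] denotes expectation over the trajectory (s_1, a_1, …, s_{H−1}, a_{H−1}) generated from s_1 = s by sampling a_h ∼ π'_h(·|s_h) and s_{h+1} ∼ p'_h(·|s_h,a_h). -/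
open scoped BigOperators Classical
open Finset

noncomputable section

variable {S : Type} [Fintype S] {A : Type} [Fintype A]

/-- Value function for a stochastic policy in a time-indexed finite-horizon MDP:
`Vstoch p c pol k h s` is the value with `k` steps to go starting at state `s` at time
`h`; the time-`h` value function of the horizon-`H` MDP is `Vstoch p c pol (H - h) h`. -/
def Vstoch (p : ℕ → S → A → S → ℝ) (c : ℕ → S → A → ℝ)
    (pol : ℕ → S → A → ℝ) : (k : ℕ) → (h : ℕ) → S → ℝ
  | 0, _, _ => 0
  | k + 1, h, s =>
      ∑ a, pol h s a * (c h s a + ∑ s', p h s a s' * Vstoch p c pol k (h + 1) s')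

/-- The `Q`-function at time `h` of the horizon-`H` MDP:
`Q_h(s,a) = c_h(s,a) + Σ_{s'} p_h(s'|s,a) V_{h+1}(s')`. -/
def Qstoch (H : ℕ) (p : ℕ → S → A → S → ℝ) (c : ℕ → S → A → ℝ)
    (pol : ℕ → S → A → ℝ) (h : ℕ) (s : S) (a : A) : ℝ :=
  c h s a + ∑ s', p h s a s' * Vstoch p c pol (H - (h + 1)) (h + 1) s'

/-- State-occupancy: `docc p pol s1 k s` is the probability that `s_{1+k} = s` for the
trajectory generated from `s_1 = s1` by sampling `a_h ∼ pol h (s_h)` and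
`s_{h+1} ∼ p h (s_h) (a_h)`. -/
def docc (p : ℕ → S → A → S → ℝ) (pol : ℕ → S → A → ℝ) (s1 : S) :
    (k : ℕ) → S → ℝ
  | 0, s => if s = s1 then 1 else 0
  | k + 1, s' =>
      ∑ s, ∑ a, docc p pol s1 k s * pol (k + 1) s a * p (k + 1) s a s'

/-- One-step decomposition of the difference of two value functions. -/
lemma Vstoch_succ_sub (p p' : ℕ → S → A → S → ℝ) (c c' : ℕ → S → A → ℝ)
    (pol pol' : ℕ → S → A → ℝ) (n h : ℕ) (s : S) :
    Vstoch p c pol (n + 1) h s - Vstoch p' c' pol' (n + 1) h s =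
      (∑ a, (c h s a + ∑ s', p h s a s' * Vstoch p c pol n (h + 1) s') *
        (pol h s a - pol' h s a)) +
      (∑ a, pol' h s a * (c h s a - c' h s a +
        ∑ s', (p h s a s' - p' h s a s') * Vstoch p c pol n (h + 1) s')) +
      ∑ a, pol' h s a * ∑ s', p' h s a s' *
        (Vstoch p c pol n (h + 1) s' - Vstoch p' c' pol' n (h + 1) s') := by
  simp only [Vstoch, ← Finset.sum_sub_distrib, ← Finset.sum_add_distrib]
  refine Finset.sum_congr rfl fun a _ => ?_
  simp only [sub_mul, mul_sub, Finset.sum_sub_distrib]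
  ring

/-- Pairing the occupancy at the next time with a function `f` averages `f` over one step. -/
lemma sum_docc_succ_mul (p : ℕ → S → A → S → ℝ) (pol : ℕ → S → A → ℝ) (s₁ : S) (k : ℕ)
    (f : S → ℝ) :
    ∑ s', docc p pol s₁ (k + 1) s' * f s' =
      ∑ s, docc p pol s₁ k s *
        ∑ a, pol (k + 1) s a * ∑ s', p (k + 1) s a s' * f s' := by
  simp only [docc, Finset.sum_mul, Finset.mul_sum]
  rw [Finset.sum_comm]
  refine Finset.sum_congr rfl fun s _ => ?_
  rw [Finset.sum_comm]
  refine Finset.sum_congr rfl fun a _ => Finset.sum_congr rfl fun s' _ => ?_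
  ring

/-- Value-difference lemma (Corollary 1 in Efroni et al., `lemma:val-diff`). -/
theorem stmt14
    (H : ℕ) (hH : 1 ≤ H)
    (p p' : ℕ → S → A → S → ℝ)
    (hp0 : ∀ h, 1 ≤ h → h ≤ H - 1 → ∀ s a s', 0 ≤ p h s a s')
    (hp1 : ∀ h, 1 ≤ h → h ≤ H - 1 → ∀ s a, (∑ s', p h s a s') = 1)
    (hp'0 : ∀ h, 1 ≤ h → h ≤ H - 1 → ∀ s a s', 0 ≤ p' h s a s')
    (hp'1 : ∀ h, 1 ≤ h → h ≤ H - 1 → ∀ s a, (∑ s', p' h s a s') = 1)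
    (c c' : ℕ → S → A → ℝ)
    (pol pol' : ℕ → S → A → ℝ)
    (hpol0 : ∀ h, 1 ≤ h → h ≤ H - 1 → ∀ s a, 0 ≤ pol h s a)
    (hpol1 : ∀ h, 1 ≤ h → h ≤ H - 1 → ∀ s, (∑ a, pol h s a) = 1)
    (hpol'0 : ∀ h, 1 ≤ h → h ≤ H - 1 → ∀ s a, 0 ≤ pol' h s a)
    (hpol'1 : ∀ h, 1 ≤ h → h ≤ H - 1 → ∀ s, (∑ a, pol' h s a) = 1) :
    ∀ s : S,
      Vstoch p c pol (H - 1) 1 s - Vstoch p' c' pol' (H - 1) 1 s =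
        (∑ k ∈ Finset.range (H - 1), ∑ sh : S,
            docc p' pol' s k sh *
              ∑ a : A, Qstoch H p c pol (k + 1) sh a *
                (pol (k + 1) sh a - pol' (k + 1) sh a)) +
        (∑ k ∈ Finset.range (H - 1), ∑ sh : S, ∑ a : A,
            docc p' pol' s k sh * pol' (k + 1) sh a *
              (c (k + 1) sh a - c' (k + 1) sh a +
                ∑ s' : S, (p (k + 1) sh a s' - p' (k + 1) sh a s') *
                  Vstoch p c pol (H - (k + 2)) (k + 2) s')) := by
  intro s
  let Φ : ℕ → ℝ := fun k => ∑ sh, docc p' pol' s k sh *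
    (Vstoch p c pol (H - 1 - k) (k + 1) sh - Vstoch p' c' pol' (H - 1 - k) (k + 1) sh)
  have hΦ_zero : Φ 0 = Vstoch p c pol (H - 1) 1 s - Vstoch p' c' pol' (H - 1) 1 s := by
    simp [Φ, docc]
  have hΦ_last : Φ (H - 1) = 0 := by simp [Φ, Vstoch]
  rw [← hΦ_zero, ← sub_zero (Φ 0), ← hΦ_last, ← Finset.sum_range_sub',
    ← Finset.sum_add_distrib]
  refine Finset.sum_congr rfl fun k hk => ?_
  have hk' := Finset.mem_range.mp hk
  have h₁ : H - 1 - k = H - (k + 2) + 1 := by omega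
  have h₂ : H - 1 - (k + 1) = H - (k + 2) := by omega
  simp only [Φ, h₁, h₂]
  rw [sum_docc_succ_mul, ← Finset.sum_sub_distrib, ← Finset.sum_add_distrib]
  refine Finset.sum_congr rfl fun sh _ => ?_
  rw [Vstoch_succ_sub]
  simp only [Qstoch, mul_assoc, ← Finset.mul_sum]
  ring

end
end
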